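/- For every integer K ≥ 3 there exists a parameter θ_K ∈ (0, π/4) such that the map F = F_{θ_K} satisfies: F^k([E₁, P₄]) ⊆ ℬ₁ for every 0 ≤ k < K, and F^K([E₁, P₄]) = [E₁, P₁]. Moreover θ_K → π/4 as K → ∞, in the following sense: for every ε > 0 there is K₀ such that for all K ≥ K₀, every θ ∈ (0, π/4) with the above property satisfies θ > π/4 − ε. -/

import Mathlib

open Real Set Filter

noncomputable section

/-- A point in the plane. -/
abbrev Pt : Type := ℝ × ℝ

/-- The unit square `Q = [0,1] × [0,1]`. -/
def unitSq : Set Pt := Icc (0:ℝ) 1 ×ˢ Icc (0:ℝ) 1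

/-- The corners `E₁, E₂, E₃, E₄` of the unit square (cyclically indexed). -/
def Ept : Fin 4 → Pt := ![(0,0), (1,0), (1,1), (0,1)]

/-- The inner points `P₁, P₂, P₃, P₄` (cyclically indexed). -/
def Ppt (s t : ℝ) : Fin 4 → Pt := ![(s,t), (1-t,s), (1-s,1-t), (t,1-s)]

/-- The image points `P₁′, P₂′, P₃′, P₄′` (cyclically indexed). -/
def Ppt' (s t : ℝ) : Fin 4 → Pt := ![(1-s,t), (1-t,1-s), (s,1-t), (t,s)]

/-- The triangle `𝒜ᵢ = conv {Eᵢ, Eᵢ₊₁, Pᵢ}`. -/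
def Apiece (s t : ℝ) (i : Fin 4) : Set Pt :=
  convexHull ℝ {Ept i, Ept (i+1), Ppt s t i}

/-- The triangle `ℬᵢ = conv {Eᵢ, Pᵢ, Pᵢ₋₁}`. -/
def Bpiece (s t : ℝ) (i : Fin 4) : Set Pt :=
  convexHull ℝ {Ept i, Ppt s t i, Ppt s t (i-1)}

/-- The central square `𝒞 = conv {P₁, P₂, P₃, P₄}`. -/
def Cpiece (s t : ℝ) : Set Pt :=
  convexHull ℝ {Ppt s t 0, Ppt s t 1, Ppt s t 2, Ppt s t 3}

/-- `F : Q → Q` is continuous, affine on each of the nine pieces, fixes the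
corners `Eᵢ` and maps `Pᵢ` to `Pᵢ′`. -/
def IsPAMap (s t : ℝ) (F : Pt → Pt) : Prop :=
  MapsTo F unitSq unitSq ∧
  ContinuousOn F unitSq ∧
  (∀ i : Fin 4, ∃ g : Pt →ᵃ[ℝ] Pt, EqOn F g (Apiece s t i)) ∧
  (∀ i : Fin 4, ∃ g : Pt →ᵃ[ℝ] Pt, EqOn F g (Bpiece s t i)) ∧
  (∃ g : Pt →ᵃ[ℝ] Pt, EqOn F g (Cpiece s t)) ∧
  (∀ i : Fin 4, F (Ept i) = Ept i) ∧
  (∀ i : Fin 4, F (Ppt s t i) = Ppt' s t i)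

/-- `t = sin²θ`. -/
def tof (θ : ℝ) : ℝ := sin θ ^ 2

/-- `s = sinθ·cosθ`. -/
def sof (θ : ℝ) : ℝ := sin θ * cos θ

/-- The property of the parameter `θ` (for a given `K`): for the map `F = F_θ`,
`F^k([E₁,P₄]) ⊆ ℬ₁` for all `0 ≤ k < K` and `F^K([E₁,P₄]) = [E₁,P₁]`. -/
def GoodParam (K : ℕ) (θ : ℝ) : Prop :=
  ∀ F : Pt → Pt, IsPAMap (sof θ) (tof θ) F →
    (∀ k < K, F^[k] '' segment ℝ (Ept 0) (Ppt (sof θ) (tof θ) 3)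
        ⊆ Bpiece (sof θ) (tof θ) 0) ∧
    F^[K] '' segment ℝ (Ept 0) (Ppt (sof θ) (tof θ) 3)
      = segment ℝ (Ept 0) (Ppt (sof θ) (tof θ) 0)

/-! ### The parameters -/

/-- The relations between the parameters `s` and `t` induced by `θ ∈ (0, π/4)`. -/
structure Admissible (s t : ℝ) : Prop where
  t_pos : 0 < t
  t_lt_s : t < s
  s_lt : s < 1 / 2
  sq_eq : s ^ 2 = t - t ^ 2

theorem admissible_of_mem_Ioo {θ : ℝ} (hθ : θ ∈ Ioo 0 (π / 4)) :
    Admissible (sof θ) (tof θ) := by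
  obtain ⟨h0, h1⟩ := hθ
  have hs : 0 < sin θ := sin_pos_of_pos_of_lt_pi h0 (by linarith [pi_pos])
  have hlt : sin θ < cos θ := by
    rw [← cos_pi_div_two_sub]
    exact cos_lt_cos_of_nonneg_of_le_pi h0.le (by linarith) (by linarith)
  have hsq := sin_sq_add_cos_sq θ
  refine ⟨by unfold tof; positivity, ?_, ?_, ?_⟩ <;> unfold sof
  · unfold tof; nlinarith
  · nlinarith [mul_pos (sub_pos.2 hlt) (sub_pos.2 hlt)]
  · unfold tof; linear_combination sin θ ^ 2 * hsq

/-! ### Construction of the piecewise affine map -/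

/-- The affine form `(x, y) ↦ p x + q y + r`. -/
def affineForm (p q r : ℝ) : Pt →ᵃ[ℝ] ℝ :=
  (p • LinearMap.fst ℝ ℝ ℝ + q • LinearMap.snd ℝ ℝ ℝ).toAffineMap + AffineMap.const ℝ Pt r

@[simp]
theorem affineForm_apply (p q r : ℝ) (x : Pt) : affineForm p q r x = p * x.1 + q * x.2 + r := by
  simp [affineForm]

theorem affineMap_le_on_convexHull {V : Set Pt} {f g : Pt →ᵃ[ℝ] ℝ}
    (h : ∀ v ∈ V, f v ≤ g v) : ∀ x ∈ convexHull ℝ V, f x ≤ g x := by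
  have hc : Convex ℝ {x | f x ≤ g x} := by
    have e : {x | f x ≤ g x} = (f - g) ⁻¹' Iic 0 := by
      ext x
      simp
    exact e ▸ (convex_Iic (0 : ℝ)).affine_preimage (f - g)
  exact fun x hx => convexHull_min h hc hx

/-- `f` coincides with an affine form on `S`. -/
def AffineOn (f : Pt → ℝ) (S : Set Pt) : Prop := ∃ g : Pt →ᵃ[ℝ] ℝ, EqOn f g S

theorem AffineOn.sub {f g : Pt → ℝ} {S : Set Pt} (hf : AffineOn f S) (hg : AffineOn g S) :
    AffineOn (fun x => f x - g x) S := by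
  obtain ⟨u, hu⟩ := hf
  obtain ⟨v, hv⟩ := hg
  exact ⟨u - v, fun x hx => by simp [hu hx, hv hx]⟩

/-- The quarter turn of the unit square mapping `Eᵢ₊₁` to `Eᵢ`. -/
def quarterTurn : Pt →ᵃ[ℝ] Pt := (affineForm 0 1 0).prod (affineForm (-1) 0 1)

@[simp]
theorem quarterTurn_apply (x : Pt) : quarterTurn x = (x.2, 1 - x.1) := by
  ext <;> simp [quarterTurn]
  ring

theorem AffineOn.comp_quarterTurn {f : Pt → ℝ} {S T : Set Pt} (hf : AffineOn f T)
    (h : MapsTo quarterTurn S T) : AffineOn (fun x => f (quarterTurn x)) S := by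
  obtain ⟨u, hu⟩ := hf
  exact ⟨u.comp quarterTurn, fun x hx => by simpa using hu (h hx)⟩

theorem mapsTo_quarterTurn_convexHull {V W : Set Pt} (h : MapsTo quarterTurn V W) :
    MapsTo quarterTurn (convexHull ℝ V) (convexHull ℝ W) :=
  convexHull_min (fun _ hv => subset_convexHull ℝ W (h hv))
    ((convex_convexHull ℝ W).affine_preimage quarterTurn)

theorem quarterTurn_Ept (i : Fin 4) : quarterTurn (Ept (i + 1)) = Ept i := by
  fin_cases i <;> simp [Ept]

theorem quarterTurn_Ppt (s t : ℝ) (i : Fin 4) : quarterTurn (Ppt s t (i + 1)) = Ppt s t i := by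
  fin_cases i <;> simp [Ppt]

theorem mapsTo_quarterTurn_Apiece (s t : ℝ) (i : Fin 4) :
    MapsTo quarterTurn (Apiece s t (i + 1)) (Apiece s t i) := by
  refine mapsTo_quarterTurn_convexHull ?_
  rintro x (rfl | rfl | rfl) <;> simp only [quarterTurn_Ept, quarterTurn_Ppt] <;> simp

theorem mapsTo_quarterTurn_Bpiece (s t : ℝ) (i : Fin 4) :
    MapsTo quarterTurn (Bpiece s t (i + 1)) (Bpiece s t i) := by
  have h : i + 1 - 1 = i - 1 + 1 := by revert i; decide
  refine mapsTo_quarterTurn_convexHull ?_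
  rw [h]
  rintro x (rfl | rfl | rfl) <;> simp only [quarterTurn_Ept, quarterTurn_Ppt] <;> simp

theorem mapsTo_quarterTurn_Cpiece (s t : ℝ) :
    MapsTo quarterTurn (Cpiece s t) (Cpiece s t) := by
  refine mapsTo_quarterTurn_convexHull ?_
  rintro x (rfl | rfl | rfl | rfl)
  · right; right; right; exact quarterTurn_Ppt s t 3
  · left; exact quarterTurn_Ppt s t 0
  · right; left; exact quarterTurn_Ppt s t 1
  · right; right; left; exact quarterTurn_Ppt s t 2

/-- The affine form vanishing on the edge `[E₁, E₂]`, with value `1` at `P₁`. -/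
def tentSouth (t : ℝ) : Pt →ᵃ[ℝ] ℝ := affineForm 0 (1 / t) 0

/-- The affine form vanishing on the edge `[E₁, P₄]`, with value `1` at `P₁`. -/
def tentWest (s t : ℝ) : Pt →ᵃ[ℝ] ℝ := affineForm ((1 - s) / (s - t)) (-t / (s - t)) 0

/-- The affine form vanishing on the edge `[E₂, P₂]`, with value `1` at `P₁`. -/
def tentEast (s t : ℝ) : Pt →ᵃ[ℝ] ℝ := affineForm (-s / (s - t)) (-t / (s - t)) (s / (s - t))

/-- The affine form vanishing on the diagonal `[P₂, P₄]`, with value `1` at `P₁`. -/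
def tentNorth (s t : ℝ) : Pt →ᵃ[ℝ] ℝ :=
  affineForm (-1) (-(1 - 2 * t) / (1 - 2 * s)) ((1 - s - t) / (1 - 2 * s))

/-- The tent function over the quadrilateral `E₁E₂P₂P₄` with peak `1` at `P₁`. -/
def tent (s t : ℝ) (x : Pt) : ℝ :=
  max 0 (min (min (tentSouth t x) (tentWest s t x)) (min (tentEast s t x) (tentNorth s t x)))

/-- The explicit piecewise affine map `F_θ`. -/
def paMap (s t : ℝ) (x : Pt) : Pt :=
  (x.1 + (1 - 2 * s) *
      (tent s t x - tent s t (quarterTurn (quarterTurn x))),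
   x.2 + (1 - 2 * s) *
      (tent s t (quarterTurn x) - tent s t (quarterTurn (quarterTurn (quarterTurn x)))))


theorem tent_eq_zero_of_south {s t : ℝ} {x : Pt} (h : tentSouth t x ≤ 0) : tent s t x = 0 :=
  max_eq_left ((min_le_left _ _).trans ((min_le_left _ _).trans h))

theorem tent_eq_zero_of_west {s t : ℝ} {x : Pt} (h : tentWest s t x ≤ 0) : tent s t x = 0 :=
  max_eq_left ((min_le_left _ _).trans ((min_le_right _ _).trans h))

theorem tent_eq_zero_of_east {s t : ℝ} {x : Pt} (h : tentEast s t x ≤ 0) : tent s t x = 0 :=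
  max_eq_left ((min_le_right _ _).trans ((min_le_left _ _).trans h))

theorem tent_eq_zero_of_north {s t : ℝ} {x : Pt} (h : tentNorth s t x ≤ 0) : tent s t x = 0 :=
  max_eq_left ((min_le_right _ _).trans ((min_le_right _ _).trans h))

theorem affineOn_of_eqOn_zero {f : Pt → ℝ} {S : Set Pt} (h : ∀ x ∈ S, f x = 0) : AffineOn f S :=
  ⟨AffineMap.const ℝ Pt 0, fun x hx => by simpa using h x hx⟩

theorem affineForm_le_on_triangle {p q r p' q' r' : ℝ} {u v w : Pt}
    (hu : p * u.1 + q * u.2 + r ≤ p' * u.1 + q' * u.2 + r')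
    (hv : p * v.1 + q * v.2 + r ≤ p' * v.1 + q' * v.2 + r')
    (hw : p * w.1 + q * w.2 + r ≤ p' * w.1 + q' * w.2 + r') :
    ∀ x ∈ convexHull ℝ {u, v, w}, affineForm p q r x ≤ affineForm p' q' r' x := by
  apply affineMap_le_on_convexHull
  rintro x (rfl | rfl | rfl) <;> simpa

theorem affineForm_nonpos_on_triangle {p q r : ℝ} {u v w : Pt}
    (hu : p * u.1 + q * u.2 + r ≤ 0) (hv : p * v.1 + q * v.2 + r ≤ 0)
    (hw : p * w.1 + q * w.2 + r ≤ 0) :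
    ∀ x ∈ convexHull ℝ {u, v, w}, affineForm p q r x ≤ 0 := by
  intro x hx
  have := affineForm_le_on_triangle (p' := 0) (q' := 0) (r' := 0) (by simpa using hu)
    (by simpa using hv) (by simpa using hw) x hx
  simpa using this

theorem affineForm_nonneg_on_triangle {p q r : ℝ} {u v w : Pt}
    (hu : 0 ≤ p * u.1 + q * u.2 + r) (hv : 0 ≤ p * v.1 + q * v.2 + r)
    (hw : 0 ≤ p * w.1 + q * w.2 + r) :
    ∀ x ∈ convexHull ℝ {u, v, w}, 0 ≤ affineForm p q r x := by
  intro x hx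
  have := affineForm_le_on_triangle (p := 0) (q := 0) (r := 0) (by simpa using hu)
    (by simpa using hv) (by simpa using hw) x hx
  simpa using this

theorem affineOn_tent_Apiece {s t : ℝ} (h : Admissible s t) (i : Fin 4) :
    AffineOn (tent s t) (Apiece s t i) := by
  obtain ⟨h0, h1, h2, h3⟩ := h
  have d1 : 0 < s - t := by linarith
  have d2 : 0 < 1 - 2 * s := by linarith
  have d3 : 0 < 1 - s * 2 := by linarith
  fin_cases i
  · refine ⟨tentSouth t, fun x hx => ?_⟩
    have nonneg : 0 ≤ tentSouth t x := by
      refine affineForm_nonneg_on_triangle ?_ ?_ ?_ x hx <;> simp [Ept, Ppt]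
      field_simp
      norm_num
    have west : tentSouth t x ≤ tentWest s t x := by
      refine affineForm_le_on_triangle ?_ ?_ ?_ x hx <;> simp [Ept, Ppt] <;> field_simp
      all_goals nlinarith
    have east : tentSouth t x ≤ tentEast s t x := by
      refine affineForm_le_on_triangle ?_ ?_ ?_ x hx <;> simp [Ept, Ppt] <;> field_simp
      all_goals nlinarith
    have north : tentSouth t x ≤ tentNorth s t x := by
      refine affineForm_le_on_triangle ?_ ?_ ?_ x hx <;> simp [Ept, Ppt] <;> field_simp
      all_goals nlinarith
    simp [tent, nonneg, west, east, north]
  · refine affineOn_of_eqOn_zero fun x hx => tent_eq_zero_of_east ?_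
    refine affineForm_nonpos_on_triangle ?_ ?_ ?_ x hx <;> simp [Ept, Ppt] <;> field_simp
    all_goals nlinarith
  · refine affineOn_of_eqOn_zero fun x hx => tent_eq_zero_of_north ?_
    refine affineForm_nonpos_on_triangle ?_ ?_ ?_ x hx <;> simp [Ept, Ppt] <;> field_simp
    all_goals nlinarith
  · refine affineOn_of_eqOn_zero fun x hx => tent_eq_zero_of_west ?_
    refine affineForm_nonpos_on_triangle ?_ ?_ ?_ x hx <;> simp [Ept, Ppt] <;> field_simp
    all_goals nlinarith

theorem affineOn_tent_Bpiece {s t : ℝ} (h : Admissible s t) (i : Fin 4) :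
    AffineOn (tent s t) (Bpiece s t i) := by
  obtain ⟨h0, h1, h2, h3⟩ := h
  have d1 : 0 < s - t := by linarith
  have d2 : 0 < 1 - 2 * s := by linarith
  have d3 : 0 < 1 - s * 2 := by linarith
  fin_cases i
  · refine ⟨tentWest s t, fun x hx => ?_⟩
    have nonneg : 0 ≤ tentWest s t x := by
      refine affineForm_nonneg_on_triangle ?_ ?_ ?_ x hx <;> simp [Ept, Ppt] <;> field_simp
      all_goals nlinarith
    have south : tentWest s t x ≤ tentSouth t x := by
      refine affineForm_le_on_triangle ?_ ?_ ?_ x hx <;> simp [Ept, Ppt] <;> field_simp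
      all_goals nlinarith
    have east : tentWest s t x ≤ tentEast s t x := by
      refine affineForm_le_on_triangle ?_ ?_ ?_ x hx <;> simp [Ept, Ppt] <;> field_simp
      all_goals nlinarith
    have north : tentWest s t x ≤ tentNorth s t x := by
      refine affineForm_le_on_triangle ?_ ?_ ?_ x hx <;> simp [Ept, Ppt] <;> field_simp
      all_goals nlinarith
    simp [tent, nonneg, south, east, north]
  · refine ⟨tentEast s t, fun x hx => ?_⟩
    have nonneg : 0 ≤ tentEast s t x := by
      refine affineForm_nonneg_on_triangle ?_ ?_ ?_ x hx <;> simp [Ept, Ppt] <;> field_simp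
      all_goals nlinarith
    have south : tentEast s t x ≤ tentSouth t x := by
      refine affineForm_le_on_triangle ?_ ?_ ?_ x hx <;> simp [Ept, Ppt] <;> field_simp
      all_goals nlinarith
    have west : tentEast s t x ≤ tentWest s t x := by
      refine affineForm_le_on_triangle ?_ ?_ ?_ x hx <;> simp [Ept, Ppt] <;> field_simp
      all_goals nlinarith
    have north : tentEast s t x ≤ tentNorth s t x := by
      refine affineForm_le_on_triangle ?_ ?_ ?_ x hx <;> simp [Ept, Ppt] <;> field_simp
      all_goals nlinarith
    simp [tent, nonneg, south, west, north]
  · refine affineOn_of_eqOn_zero fun x hx => tent_eq_zero_of_north ?_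
    refine affineForm_nonpos_on_triangle ?_ ?_ ?_ x hx <;> simp [Ept, Ppt] <;> field_simp
    all_goals nlinarith
  · refine affineOn_of_eqOn_zero fun x hx => tent_eq_zero_of_north ?_
    refine affineForm_nonpos_on_triangle ?_ ?_ ?_ x hx <;> simp [Ept, Ppt] <;> field_simp
    all_goals nlinarith

theorem tent_eq_on_Cpiece {s t : ℝ} (h : Admissible s t) {x : Pt} (hx : x ∈ Cpiece s t) :
    tent s t x = max 0 (tentNorth s t x) := by
  obtain ⟨h0, h1, h2, h3⟩ := h
  have d1 : 0 < s - t := by linarith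
  have d2 : 0 < 1 - 2 * s := by linarith
  have d3 : 0 < 1 - s * 2 := by linarith
  have south : tentNorth s t x ≤ tentSouth t x := by
    refine affineMap_le_on_convexHull (g := tentSouth t) ?_ x hx
    rintro v (rfl | rfl | rfl | rfl) <;> simp [tentNorth, tentSouth, Ppt] <;> field_simp
    all_goals nlinarith
  have west : tentNorth s t x ≤ tentWest s t x := by
    refine affineMap_le_on_convexHull (g := tentWest s t) ?_ x hx
    rintro v (rfl | rfl | rfl | rfl) <;> simp [tentNorth, tentWest, Ppt] <;> field_simp
    all_goals nlinarith
  have east : tentNorth s t x ≤ tentEast s t x := by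
    refine affineMap_le_on_convexHull (g := tentEast s t) ?_ x hx
    rintro v (rfl | rfl | rfl | rfl) <;> simp [tentNorth, tentEast, Ppt] <;> field_simp
    all_goals nlinarith
  simp [tent, south, west, east]

theorem tentNorth_quarterTurn_twice {s t : ℝ} (h : Admissible s t) (x : Pt) :
    tentNorth s t (quarterTurn (quarterTurn x)) = -tentNorth s t x := by
  have d : 1 - 2 * s ≠ 0 := by linarith [h.s_lt]
  simp [tentNorth]
  field_simp
  ring

theorem affineOn_tent_sub_Cpiece {s t : ℝ} (h : Admissible s t) :
    AffineOn (fun x => tent s t x - tent s t (quarterTurn (quarterTurn x))) (Cpiece s t) := by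
  refine ⟨tentNorth s t, fun x hx => ?_⟩
  have hx' := mapsTo_quarterTurn_Cpiece s t (mapsTo_quarterTurn_Cpiece s t hx)
  dsimp only
  rw [tent_eq_on_Cpiece h hx, tent_eq_on_Cpiece h hx', tentNorth_quarterTurn_twice h]
  rcases le_total 0 (tentNorth s t x) with hn | hn <;> simp [hn]

theorem exists_affine_paMap {s t : ℝ} {S : Set Pt}
    (h₁ : AffineOn (fun x => tent s t x - tent s t (quarterTurn (quarterTurn x))) S)
    (h₂ : AffineOn (fun x => tent s t (quarterTurn x) -
      tent s t (quarterTurn (quarterTurn (quarterTurn x)))) S) :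
    ∃ g : Pt →ᵃ[ℝ] Pt, EqOn (paMap s t) g S := by
  obtain ⟨u, hu⟩ := h₁
  obtain ⟨v, hv⟩ := h₂
  refine ⟨AffineMap.id ℝ Pt + (1 - 2 * s) • u.prod v, fun x hx => ?_⟩
  have hux := hu hx
  have hvx := hv hx
  dsimp only at hux hvx
  simp only [paMap, hux, hvx]
  ext <;> simp

theorem mul_tent_le {s t : ℝ} (h : Admissible s t) {x : Pt} (hx : x ∈ unitSq) :
    (1 - 2 * s) * tent s t x ≤ 1 - x.1 := by
  obtain ⟨h0, h1, h2, h3⟩ := h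
  obtain ⟨⟨hx1, hx2⟩, hx3, hx4⟩ := hx
  have d : 0 < s - t := by linarith
  rcases le_total (tentEast s t x) 0 with he | he
  · rw [tent_eq_zero_of_east he]
    linarith
  have hle : tent s t x ≤ tentEast s t x :=
    max_le he ((min_le_right _ _).trans (min_le_left _ _))
  have hval : tentEast s t x ≤ s * (1 - x.1) / (s - t) := by
    simp [tentEast]
    field_simp
    nlinarith
  calc (1 - 2 * s) * tent s t x ≤ (1 - 2 * s) * (s * (1 - x.1) / (s - t)) := by gcongr <;> linarith
    _ ≤ 1 - x.1 := by
      rw [← mul_div_assoc, div_le_iff₀ d]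
      nlinarith [mul_nonneg (sub_nonneg.2 hx2) (by nlinarith : 0 ≤ (s - t) - (1 - 2 * s) * s)]

theorem tent_nonneg (s t : ℝ) (x : Pt) : 0 ≤ tent s t x := le_max_left _ _

theorem quarterTurn_mem_unitSq {x : Pt} (hx : x ∈ unitSq) : quarterTurn x ∈ unitSq := by
  obtain ⟨⟨hx1, hx2⟩, hx3, hx4⟩ := hx
  simp only [quarterTurn_apply]
  exact ⟨⟨hx3, hx4⟩, by dsimp; linarith, by dsimp; linarith⟩

theorem mapsTo_paMap_unitSq {s t : ℝ} (h : Admissible s t) : MapsTo (paMap s t) unitSq unitSq := by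
  intro x hx
  have hx₁ := quarterTurn_mem_unitSq hx
  have hx₂ := quarterTurn_mem_unitSq hx₁
  have hx₃ := quarterTurn_mem_unitSq hx₂
  have b₀ := mul_tent_le h hx
  have b₁ := mul_tent_le h hx₁
  have b₂ := mul_tent_le h hx₂
  have b₃ := mul_tent_le h hx₃
  have d : 0 ≤ 1 - 2 * s := by linarith [h.s_lt]
  have n₀ := mul_nonneg d (tent_nonneg s t x)
  have n₁ := mul_nonneg d (tent_nonneg s t (quarterTurn x))
  have n₂ := mul_nonneg d (tent_nonneg s t (quarterTurn (quarterTurn x)))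
  have n₃ := mul_nonneg d (tent_nonneg s t (quarterTurn (quarterTurn (quarterTurn x))))
  simp only [quarterTurn_apply] at b₀ b₁ b₂ b₃ n₀ n₁ n₂ n₃
  refine ⟨⟨?_, ?_⟩, ?_, ?_⟩ <;> simp only [paMap, quarterTurn_apply] <;> linarith

theorem continuous_paMap (s t : ℝ) : Continuous (paMap s t) := by
  unfold paMap tent tentSouth tentWest tentEast tentNorth
  simp only [affineForm_apply, quarterTurn_apply]
  fun_prop

theorem tent_Ept {s t : ℝ} (h : Admissible s t) (i : Fin 4) : tent s t (Ept i) = 0 := by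
  obtain ⟨h0, h1, h2, h3⟩ := h
  have d1 : 0 < s - t := by linarith
  fin_cases i
  · apply tent_eq_zero_of_south; simp [tentSouth, Ept]
  · apply tent_eq_zero_of_south; simp [tentSouth, Ept]
  · apply tent_eq_zero_of_east; simp [tentEast, Ept]; field_simp; nlinarith
  · apply tent_eq_zero_of_west; simp [tentWest, Ept]; field_simp; nlinarith

theorem tent_Ppt_zero {s t : ℝ} (h : Admissible s t) : tent s t (Ppt s t 0) = 1 := by
  obtain ⟨h0, h1, h2, h3⟩ := h
  have d1 : 0 < s - t := by linarith
  have d2 : 0 < 1 - 2 * s := by linarith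
  have d3 : 0 < 1 - s * 2 := by linarith
  have south : tentSouth t (Ppt s t 0) = 1 := by simp [tentSouth, Ppt, h0.ne']
  have west : tentWest s t (Ppt s t 0) = 1 := by
    simp [tentWest, Ppt]; field_simp; nlinarith
  have east : tentEast s t (Ppt s t 0) = 1 := by
    simp [tentEast, Ppt]; field_simp; nlinarith
  have north : tentNorth s t (Ppt s t 0) = 1 := by
    simp [tentNorth, Ppt]; field_simp; nlinarith
  simp [tent, south, west, east, north]

theorem tent_Ppt {s t : ℝ} (h : Admissible s t) {i : Fin 4} (hi : i ≠ 0) :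
    tent s t (Ppt s t i) = 0 := by
  obtain ⟨h0, h1, h2, h3⟩ := h
  have d2 : 0 < 1 - 2 * s := by linarith
  have d3 : 0 < 1 - s * 2 := by linarith
  apply tent_eq_zero_of_north
  fin_cases i
  · exact absurd rfl hi
  all_goals simp [tentNorth, Ppt]; field_simp; nlinarith

theorem isPAMap_paMap {s t : ℝ} (h : Admissible s t) : IsPAMap s t (paMap s t) := by
  have hA (i : Fin 4) : MapsTo quarterTurn (Apiece s t i) (Apiece s t (i - 1)) := by
    simpa using mapsTo_quarterTurn_Apiece s t (i - 1)
  have hB (i : Fin 4) : MapsTo quarterTurn (Bpiece s t i) (Bpiece s t (i - 1)) := by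
    simpa using mapsTo_quarterTurn_Bpiece s t (i - 1)
  have hC := mapsTo_quarterTurn_Cpiece s t
  have hE (i : Fin 4) : quarterTurn (Ept i) = Ept (i - 1) := by
    simpa using quarterTurn_Ept (i - 1)
  have hP (i : Fin 4) : quarterTurn (Ppt s t i) = Ppt s t (i - 1) := by
    simpa using quarterTurn_Ppt s t (i - 1)
  refine ⟨mapsTo_paMap_unitSq h, (continuous_paMap s t).continuousOn, fun i => ?_, fun i => ?_,
    ?_, fun i => ?_, fun i => ?_⟩
  · have key (j : Fin 4) :=
      (affineOn_tent_Apiece h j).sub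
        (((affineOn_tent_Apiece h _).comp_quarterTurn (hA _)).comp_quarterTurn (hA j))
    exact exists_affine_paMap (key i) ((key (i - 1)).comp_quarterTurn (hA i))
  · have key (j : Fin 4) :=
      (affineOn_tent_Bpiece h j).sub
        (((affineOn_tent_Bpiece h _).comp_quarterTurn (hB _)).comp_quarterTurn (hB j))
    exact exists_affine_paMap (key i) ((key (i - 1)).comp_quarterTurn (hB i))
  · have key := affineOn_tent_sub_Cpiece h
    exact exists_affine_paMap key (key.comp_quarterTurn hC)
  · simp only [paMap, hE, tent_Ept h]
    simp
  · have n1 := tent_Ppt h (i := 1) (by decide)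
    have n2 := tent_Ppt h (i := 2) (by decide)
    have n3 := tent_Ppt h (i := 3) (by decide)
    have n0 := tent_Ppt_zero h
    have m1 : (0 : Fin 4) - 1 = 3 := rfl
    have m2 : (3 : Fin 4) - 1 = 2 := rfl
    have m3 : (2 : Fin 4) - 1 = 1 := rfl
    simp only [paMap, hP]
    fin_cases i <;> simp [m1, m2, m3, n0, n1, n2, n3] <;> simp [Ppt, Ppt'] <;> ring_nf

/-! ### The linear dynamics on `ℬ₁` -/

/-- The map `F` on `ℬ₁` in the basis `P₁, P₄`. -/
def stepCoord (s t : ℝ) (p : ℝ × ℝ) : ℝ × ℝ :=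
  ((s / t - 1 + s + t) * p.1 + (s - t) * p.2, (s + t) * p.2 - (s - t) * p.1)

/-- The coordinates of `Fᵏ(P₄)` in the basis `P₁, P₄`, as long as the orbit stays in `ℬ₁`. -/
def orbit (s t : ℝ) (k : ℕ) : ℝ × ℝ := (stepCoord s t)^[k] (0, 1)

@[simp]
theorem orbit_zero (s t : ℝ) : orbit s t 0 = (0, 1) := rfl

theorem orbit_succ (s t : ℝ) (k : ℕ) : orbit s t (k + 1) = stepCoord s t (orbit s t k) :=
  Function.iterate_succ_apply' _ _ _

theorem orbit_succ_fst (s t : ℝ) (k : ℕ) : (orbit s t (k + 1)).1 =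
    (s / t - 1 + s + t) * (orbit s t k).1 + (s - t) * (orbit s t k).2 := by
  rw [orbit_succ]; rfl

theorem orbit_succ_snd (s t : ℝ) (k : ℕ) : (orbit s t (k + 1)).2 =
    (s + t) * (orbit s t k).2 - (s - t) * (orbit s t k).1 := by
  rw [orbit_succ]; rfl

theorem orbit_invariant {s t : ℝ} (h : Admissible s t) (k : ℕ) :
    t * ((orbit s t k).1 ^ 2 + (orbit s t k).2 ^ 2) + (orbit s t k).1 * (orbit s t k).2 = t := by
  induction k with
  | zero => simp
  | succ k ih =>
    rw [orbit_succ_fst, orbit_succ_snd]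
    obtain ⟨h0, -, -, h3⟩ := h
    have hw : s / t * t = s := div_mul_cancel₀ _ h0.ne'
    have hw' : s / t * s = 1 - t := by field_simp; linarith
    generalize s / t = w at *
    generalize (orbit s t k).1 = a at *
    generalize (orbit s t k).2 = b at *
    grind

theorem orbit_snd_recurrence {s t : ℝ} (h : Admissible s t) (k : ℕ) : (orbit s t (k + 2)).2 =
    (s / t - 1 + 2 * s + 2 * t) * (orbit s t (k + 1)).2 - (orbit s t k).2 := by
  rw [orbit_succ_snd, orbit_succ_snd, orbit_succ_fst]
  obtain ⟨h0, -, -, h3⟩ := h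
  have hw : s / t * t = s := div_mul_cancel₀ _ h0.ne'
  have hw' : s / t * s = 1 - t := by field_simp; linarith
  generalize s / t = w at *
  generalize (orbit s t k).1 = a at *
  generalize (orbit s t k).2 = b at *
  grind

theorem Admissible.two_lt_trace {s t : ℝ} (h : Admissible s t) :
    2 < s / t - 1 + 2 * s + 2 * t := by
  obtain ⟨h0, h1, h2, h3⟩ := h
  have e : s / t - 1 + 2 * s + 2 * t - 2 = (s - t) * (1 - 2 * s) / t := by
    field_simp
    linear_combination 2 * h3
  have : 0 < (s - t) * (1 - 2 * s) / t :=
    div_pos (mul_pos (by linarith) (by linarith)) h0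
  linarith

theorem orbit_snd_lt_of_nonpos {s t : ℝ} (h : Admissible s t) {k : ℕ}
    (hk : (orbit s t k).2 ≤ 0) : ∀ n, k < n → (orbit s t n).2 < 0 := by
  have hdec (m : ℕ) (h₁ : (orbit s t (m + 1)).2 ≤ 0) (h₂ : (orbit s t (m + 1)).2 < (orbit s t m).2) :
      (orbit s t (m + 2)).2 < (orbit s t (m + 1)).2 := by
    rw [orbit_snd_recurrence h]
    nlinarith [h.two_lt_trace]
  have hex : ∃ m, (orbit s t m).2 ≤ 0 := ⟨k, hk⟩
  classical
  obtain ⟨m, hm⟩ : ∃ m, Nat.find hex = m + 1 := by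
    refine Nat.exists_eq_succ_of_ne_zero fun h0 => ?_
    have := Nat.find_spec hex
    rw [h0] at this
    norm_num at this
  have h₁ : (orbit s t (m + 1)).2 ≤ 0 := hm ▸ Nat.find_spec hex
  have h₀ : 0 < (orbit s t m).2 := not_le.1 (Nat.find_min hex (by omega))
  have hmk : m + 1 ≤ k := hm ▸ Nat.find_min' hex hk
  have key (j : ℕ) : (orbit s t (m + j + 1)).2 ≤ 0 ∧
      (orbit s t (m + j + 1)).2 < (orbit s t (m + j)).2 := by
    induction j with
    | zero => exact ⟨h₁, by simpa using h₁.trans_lt h₀⟩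
    | succ j ih =>
      have := hdec _ ih.1 ih.2
      exact ⟨(this.trans_le ih.1).le, this⟩
  intro n hn
  obtain ⟨j, rfl⟩ := Nat.exists_eq_add_of_lt (show m + 1 < n by omega)
  have h₂ := (key j).1
  have h₃ := (key (j + 1)).2
  rw [show m + 1 + j + 1 = m + (j + 1) + 1 by ring]
  exact h₃.trans_le h₂

theorem orbit_fst_nonneg {s t : ℝ} (h : Admissible s t) {K : ℕ}
    (hb : ∀ k < K, 0 ≤ (orbit s t k).2) : ∀ k ≤ K, 0 ≤ (orbit s t k).1 := by
  intro k
  induction k with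
  | zero => simp
  | succ k ih =>
    intro hk
    have h₁ := hb k (by omega)
    have h₂ := ih (by omega)
    obtain ⟨h0, h1', h2, h3⟩ := h
    have : 1 ≤ s / t := (one_le_div h0).2 h1'.le
    rw [orbit_succ_fst]
    exact add_nonneg (mul_nonneg (by linarith) h₂) (mul_nonneg (by linarith) h₁)

theorem orbit_fst_add_snd_le {s t : ℝ} (h : Admissible s t) {k : ℕ}
    (ha : 0 ≤ (orbit s t k).1) (hb : 0 ≤ (orbit s t k).2) :
    (orbit s t k).1 + (orbit s t k).2 ≤ 1 := by
  have hinv := orbit_invariant h k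
  have hab := mul_nonneg ha hb
  have h0 := h.t_pos
  have ht : t < 1 / 2 := h.t_lt_s.trans h.s_lt
  have : t * ((orbit s t k).1 + (orbit s t k).2) ^ 2 ≤ t * 1 := by nlinarith
  have := le_of_mul_le_mul_left this h0
  nlinarith

theorem orbit_eq_of_snd_eq_zero {s t : ℝ} (h : Admissible s t) {k : ℕ}
    (ha : 0 ≤ (orbit s t k).1) (hb : (orbit s t k).2 = 0) : orbit s t k = (1, 0) := by
  have hinv := orbit_invariant h k
  rw [hb] at hinv
  have : (orbit s t k).1 ^ 2 = 1 := mul_left_cancel₀ h.t_pos.ne' (by linarith)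
  exact Prod.ext (by nlinarith : (orbit s t k).1 = 1) hb

/-- The point with coordinates `p` in the basis `P₁, P₄`. -/
def ofCoord (s t : ℝ) (p : ℝ × ℝ) : Pt := p.1 • Ppt s t 0 + p.2 • Ppt s t 3

theorem mem_Bpiece_zero_iff {s t : ℝ} (h : Admissible s t) (p : ℝ × ℝ) :
    ofCoord s t p ∈ Bpiece s t 0 ↔ 0 ≤ p.1 ∧ 0 ≤ p.2 ∧ p.1 + p.2 ≤ 1 := by
  have hm : (0 : Fin 4) - 1 = 3 := rfl
  obtain ⟨h0, h1, h2, h3⟩ := h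
  have d1 : 0 < s - t := by linarith
  have e₁ : affineForm ((1 - s) / (s - t)) (-t / (s - t)) 0 (ofCoord s t p) = p.1 := by
    simp [ofCoord, Ppt]
    field_simp
    linear_combination (-p.1) * h3
  have e₂ : affineForm (-t / (s - t)) (s / (s - t)) 0 (ofCoord s t p) = p.2 := by
    simp [ofCoord, Ppt]
    field_simp
    linear_combination (-p.2) * h3
  constructor
  · intro hp
    rw [Bpiece, hm] at hp
    refine ⟨?_, ?_, ?_⟩
    · rw [← e₁]
      refine affineForm_nonneg_on_triangle ?_ ?_ ?_ _ hp <;> simp [Ept, Ppt] <;> field_simp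
      all_goals nlinarith
    · rw [← e₂]
      refine affineForm_nonneg_on_triangle ?_ ?_ ?_ _ hp <;> simp [Ept, Ppt] <;> field_simp
      all_goals nlinarith
    · have := affineForm_nonneg_on_triangle (p := -(1 - s - t) / (s - t))
        (q := -(s - t) / (s - t)) (r := 1) ?_ ?_ ?_ _ hp
      · have e : affineForm (-(1 - s - t) / (s - t)) (-(s - t) / (s - t)) 1 (ofCoord s t p) =
            1 - (p.1 + p.2) := by
          rw [← e₁, ← e₂]
          simp
          ring
        rw [e] at this
        linarith
      all_goals simp [Ept, Ppt]
      all_goals field_simp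
      all_goals nlinarith
  · rintro ⟨ha, hb, hab⟩
    have hmem : ∀ i : Fin 3, ![Ept 0, Ppt s t 0, Ppt s t 3] i ∈ Bpiece s t 0 := by
      intro i
      apply subset_convexHull
      rw [hm]
      fin_cases i <;> simp
    have := (convex_convexHull ℝ _ : Convex ℝ (Bpiece s t 0)).sum_mem (t := Finset.univ)
      (w := ![1 - p.1 - p.2, p.1, p.2]) (z := ![Ept 0, Ppt s t 0, Ppt s t 3])
      (by intro i _; fin_cases i <;> simp <;> linarith) (by simp [Fin.sum_univ_three]; ring)
      (fun i _ => hmem i)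
    have hE : Ept 0 = 0 := rfl
    simp only [Fin.sum_univ_three, Matrix.cons_val, hE, smul_zero, zero_add] at this
    exact this

theorem IsPAMap.apply_ofCoord {s t : ℝ} (h : Admissible s t) {F : Pt → Pt} (hF : IsPAMap s t F)
    {p : ℝ × ℝ} (hp : ofCoord s t p ∈ Bpiece s t 0) :
    F (ofCoord s t p) = ofCoord s t (stepCoord s t p) := by
  obtain ⟨-, -, -, hB, -, hE, hP⟩ := hF
  obtain ⟨g, hg⟩ := hB 0
  have mem₀ : Ept 0 ∈ Bpiece s t 0 := subset_convexHull _ _ (by simp)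
  have mem₁ : Ppt s t 0 ∈ Bpiece s t 0 := subset_convexHull _ _ (by simp)
  have mem₂ : Ppt s t 3 ∈ Bpiece s t 0 := subset_convexHull _ _ (by right; right; rfl)
  have hz : g 0 = 0 := by
    have := (hg mem₀).symm.trans (hE 0)
    exact this
  have hlin (x : Pt) : g x = g.linear x := by
    have := congrFun g.decomp x
    simpa [hz] using this
  have e₁ : g.linear (Ppt s t 0) = Ppt' s t 0 := by rw [← hlin, ← hg mem₁, hP]
  have e₂ : g.linear (Ppt s t 3) = Ppt' s t 3 := by rw [← hlin, ← hg mem₂, hP]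
  rw [hg hp, hlin, ofCoord, map_add, map_smul, map_smul, e₁, e₂]
  obtain ⟨h0, h1, h2, h3⟩ := h
  ext <;> simp [ofCoord, stepCoord, Ppt, Ppt'] <;> field_simp
  · grind
  · grind

theorem stepCoord_smul (s t c : ℝ) (p : ℝ × ℝ) : stepCoord s t (c • p) = c • stepCoord s t p := by
  ext <;> simp [stepCoord] <;> ring

theorem iterate_smul_apply {s t : ℝ} (h : Admissible s t) {F : Pt → Pt} (hF : IsPAMap s t F)
    {c : ℝ} {k : ℕ}
    (hmem : ∀ j < k, ofCoord s t (c • orbit s t j) ∈ Bpiece s t 0) :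
    F^[k] (c • Ppt s t 3) = ofCoord s t (c • orbit s t k) := by
  induction k with
  | zero => simp [ofCoord]
  | succ k ih =>
    rw [Function.iterate_succ_apply', ih fun j hj => hmem j (by omega),
      hF.apply_ofCoord h (hmem k (by omega)), stepCoord_smul, orbit_succ]

theorem mem_segment_zero_iff (x y : Pt) :
    y ∈ segment ℝ (Ept 0) x ↔ ∃ c ∈ Icc (0 : ℝ) 1, c • x = y := by
  have hE : Ept 0 = 0 := rfl
  simp [segment_eq_image, hE]

theorem goodParam_of_orbit_snd_eq_zero {θ : ℝ} (hθ : θ ∈ Ioo 0 (π / 4)) {K : ℕ}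
    (hK : (orbit (sof θ) (tof θ) K).2 = 0) : GoodParam K θ := by
  have h := admissible_of_mem_Ioo hθ
  intro F hF
  generalize sof θ = s at *
  generalize tof θ = t at *
  have hb : ∀ k < K, 0 ≤ (orbit s t k).2 := by
    intro k hk
    by_contra! hneg
    exact (orbit_snd_lt_of_nonpos h hneg.le K hk).ne hK
  have ha := orbit_fst_nonneg h hb
  have hmem {c : ℝ} (hc : c ∈ Icc (0 : ℝ) 1) (j : ℕ) (hj : j < K) :
      ofCoord s t (c • orbit s t j) ∈ Bpiece s t 0 := by
    have hsum := orbit_fst_add_snd_le h (ha j hj.le) (hb j hj)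
    rw [mem_Bpiece_zero_iff h]
    refine ⟨mul_nonneg hc.1 (ha j hj.le), mul_nonneg hc.1 (hb j hj), ?_⟩
    simp only [Prod.smul_fst, Prod.smul_snd, smul_eq_mul]
    nlinarith [hc.1, hc.2]
  constructor
  · rintro k hk _ ⟨x, hx, rfl⟩
    obtain ⟨c, hc, rfl⟩ := (mem_segment_zero_iff _ _).1 hx
    rw [iterate_smul_apply h hF fun j hj => hmem hc j (hj.trans hk)]
    exact hmem hc k hk
  · have key {c : ℝ} (hc : c ∈ Icc (0 : ℝ) 1) : F^[K] (c • Ppt s t 3) = c • Ppt s t 0 := by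
      rw [iterate_smul_apply h hF (hmem hc), orbit_eq_of_snd_eq_zero h (ha K le_rfl) hK]
      simp [ofCoord]
    ext y
    simp only [mem_image, mem_segment_zero_iff]
    constructor
    · rintro ⟨_, ⟨c, hc, rfl⟩, rfl⟩
      exact ⟨c, hc, (key hc).symm⟩
    · rintro ⟨c, hc, rfl⟩
      exact ⟨_, ⟨c, hc, rfl⟩, key hc⟩

theorem continuousOn_orbit (k : ℕ) :
    ContinuousOn (fun θ => orbit (sof θ) (tof θ) k) (Ioc 0 (π / 4)) := by
  induction k with
  | zero => exact continuousOn_const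
  | succ k ih =>
    have hs : ContinuousOn sof (Ioc 0 (π / 4)) := by unfold sof; fun_prop
    have ht : ContinuousOn tof (Ioc 0 (π / 4)) := by unfold tof; fun_prop
    have hst : ContinuousOn (fun θ => sof θ / tof θ) (Ioc 0 (π / 4)) := by
      refine hs.div ht fun θ hθ => pow_ne_zero 2 ?_
      exact (sin_pos_of_pos_of_lt_pi hθ.1 (by linarith [hθ.2, pi_pos])).ne'
    simp only [orbit_succ, stepCoord]
    fun_prop

theorem exists_orbit_snd_eq_zero {K : ℕ} (hK : 3 ≤ K) :
    ∃ θ ∈ Ioo 0 (π / 4), (orbit (sof θ) (tof θ) K).2 = 0 := by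
  have h0 : 0 < arctan (1 / 3) := arctan_pos.2 (by norm_num)
  have h1 : arctan (1 / 3) < π / 4 := by
    rw [← arctan_one]
    exact arctan_strictMono (by norm_num)
  have hsq : √(1 + (1 / 3) ^ 2) ^ 2 = (10 / 9 : ℝ) := by
    rw [sq_sqrt (by norm_num)]
    norm_num
  have hs : sof (arctan (1 / 3)) = 3 / 10 := by
    rw [sof, sin_arctan, cos_arctan, div_mul_div_comm, ← sq, hsq]
    norm_num
  have ht : tof (arctan (1 / 3)) = 1 / 10 := by
    rw [tof, sin_arctan, div_pow, hsq]
    norm_num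
  have hneg₃ : (orbit (3 / 10) (1 / 10) 3).2 < 0 := by
    norm_num [orbit, stepCoord]
  have hneg : (orbit (sof (arctan (1 / 3))) (tof (arctan (1 / 3))) K).2 < 0 := by
    have hadm := admissible_of_mem_Ioo ⟨h0, h1⟩
    rw [hs, ht] at hadm ⊢
    rcases hK.eq_or_lt with rfl | hlt
    · exact hneg₃
    · exact orbit_snd_lt_of_nonpos hadm hneg₃.le K hlt
  have hs' : sof (π / 4) = 1 / 2 := by
    rw [sof, sin_pi_div_four, cos_pi_div_four, div_mul_div_comm, ← sq, sq_sqrt (by norm_num)]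
    norm_num
  have ht' : tof (π / 4) = 1 / 2 := by
    rw [tof, sin_pi_div_four, div_pow, sq_sqrt (by norm_num)]
    norm_num
  have hpos : 0 < (orbit (sof (π / 4)) (tof (π / 4)) K).2 := by
    have hfix : stepCoord (1 / 2) (1 / 2) (0, 1) = (0, 1) := by norm_num [stepCoord]
    rw [hs', ht', orbit, Function.iterate_fixed hfix]
    exact one_pos
  have hcont : ContinuousOn (fun θ => (orbit (sof θ) (tof θ) K).2)
      (Icc (arctan (1 / 3)) (π / 4)) :=
    ((continuousOn_orbit K).mono fun θ hθ => ⟨h0.trans_le hθ.1, hθ.2⟩).snd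
  obtain ⟨θ, hθ, hzero⟩ := intermediate_value_Ioo h1.le hcont ⟨hneg, hpos⟩
  exact ⟨θ, ⟨h0.trans hθ.1, hθ.2⟩, hzero⟩

theorem GoodParam.orbit_mem {θ : ℝ} (hθ : θ ∈ Ioo 0 (π / 4)) {K : ℕ} (hg : GoodParam K θ) :
    ∀ k < K, 0 ≤ (orbit (sof θ) (tof θ) k).1 ∧ 0 ≤ (orbit (sof θ) (tof θ) k).2 ∧
      (orbit (sof θ) (tof θ) k).1 + (orbit (sof θ) (tof θ) k).2 ≤ 1 := by
  have h := admissible_of_mem_Ioo hθ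
  have hF := isPAMap_paMap h
  obtain ⟨hmem, -⟩ := hg _ hF
  generalize sof θ = s at *
  generalize tof θ = t at *
  have key : ∀ k < K, ofCoord s t (orbit s t k) ∈ Bpiece s t 0 := by
    intro k
    induction k using Nat.strong_induction_on with
    | _ k ih =>
      intro hk
      have := iterate_smul_apply h hF (c := 1) (k := k) fun j hj => by
        simpa using ih j hj (hj.trans hk)
      rw [one_smul, one_smul] at this
      rw [← this]
      exact hmem k hk (mem_image_of_mem _ (right_mem_segment ℝ _ _))
  exact fun k hk => (mem_Bpiece_zero_iff h _).1 (key k hk)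

theorem GoodParam.mul_le_one {θ : ℝ} (hθ : θ ∈ Ioo 0 (π / 4)) {n : ℕ}
    (hg : GoodParam (n + 2) θ) : n * ((1 - 2 * sof θ) / 2) ≤ 1 := by
  have h := admissible_of_mem_Ioo hθ
  have hmem := hg.orbit_mem hθ
  generalize sof θ = s at *
  generalize tof θ = t at *
  have htr := h.two_lt_trace
  obtain ⟨h0, h1, h2, h3⟩ := h
  have hgrow : (s / t - 2 + s + t) * (s - t) = (1 - 2 * s) * (1 - s) := by
    field_simp
    grind
  have key : ∀ k ≤ n, s - t + k * ((1 - 2 * s) / 2) ≤ (orbit s t (k + 1)).1 := by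
    intro k
    induction k with
    | zero => simp [orbit_succ_fst]
    | succ k ih =>
      intro hk
      obtain ⟨-, hb, -⟩ := hmem (k + 1) (by omega)
      have ih := ih (by omega)
      have hk0 : (0 : ℝ) ≤ k * ((1 - 2 * s) / 2) := mul_nonneg k.cast_nonneg (by linarith)
      rw [orbit_succ_fst]
      push_cast
      have hA : 0 ≤ s / t - 2 + s + t := by linarith
      have hbB : 0 ≤ (s - t) * (orbit s t (k + 1)).2 := mul_nonneg (by linarith) hb
      have : (s / t - 2 + s + t) * (s - t) ≤ (s / t - 2 + s + t) * (orbit s t (k + 1)).1 :=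
        mul_le_mul_of_nonneg_left (by linarith) hA
      nlinarith
  obtain ⟨-, hb, hab⟩ := hmem (n + 1) (by omega)
  linarith [key n le_rfl]

/-- For every integer `K ≥ 3` there is `θ_K ∈ (0, π/4)` such that
`F_{θ_K}^k([E₁,P₄]) ⊆ ℬ₁` for `0 ≤ k < K` and `F_{θ_K}^K([E₁,P₄]) = [E₁,P₁]`;
moreover `θ_K → π/4` as `K → ∞`, in the sense that for every `ε > 0` there is `K₀`
such that for `K ≥ K₀` every parameter `θ ∈ (0, π/4)` with this property satisfies
`θ > π/4 - ε`. -/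
theorem exists_special_parameter :
    (∀ K : ℕ, 3 ≤ K → ∃ θ ∈ Ioo 0 (π/4), GoodParam K θ) ∧
    (∀ ε > (0:ℝ), ∃ K₀ : ℕ, ∀ K : ℕ, K₀ ≤ K →
      ∀ θ ∈ Ioo 0 (π/4), GoodParam K θ → π/4 - ε < θ) := by
  refine ⟨fun K hK => ?_, fun ε hε => ?_⟩
  · obtain ⟨θ, hθ, hzero⟩ := exists_orbit_snd_eq_zero hK
    exact ⟨θ, hθ, goodParam_of_orbit_snd_eq_zero hθ hzero⟩
  · obtain ⟨n₀, hn₀⟩ := exists_nat_gt (2 / (1 - cos (2 * ε)))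
    refine ⟨n₀ + 2, fun K hK θ hθ hg => ?_⟩
    by_contra! hle
    obtain ⟨n, rfl⟩ : ∃ n, K = n + 2 := ⟨K - 2, by omega⟩
    have hn : (n₀ : ℝ) ≤ n := by exact_mod_cast (by omega : n₀ ≤ n)
    have hcos : cos (2 * ε) < 1 := by
      rw [← cos_zero]
      exact cos_lt_cos_of_nonneg_of_le_pi le_rfl (by linarith [hθ.1, pi_pos]) (by linarith)
    have hsof : 2 * sof θ ≤ cos (2 * ε) := by
      rw [sof, ← mul_assoc, ← sin_two_mul, ← sin_pi_div_two_sub]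
      exact sin_le_sin_of_le_of_le_pi_div_two (by linarith [hθ.1, pi_pos]) (by linarith)
        (by linarith)
    rw [div_lt_iff₀ (by linarith)] at hn₀
    have hbound := hg.mul_le_one hθ
    have : (n₀ : ℝ) * (1 - cos (2 * ε)) ≤ n * (1 - 2 * sof θ) :=
      mul_le_mul hn (by linarith) (by linarith) n.cast_nonneg
    linarith
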